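/- Let q be a prime power and 2 ≤ d ≤ r ≤ n ≤ m. Then A_R(q,m,n,d,r) ≥ M(q,m,n,d,r) and M(q,m,n,d,r) > [n r]_q · q^{m(r−d)}. -/

import Mathlib

open Module

noncomputable def injDist {F V : Type*} [Field F] [AddCommGroup V] [Module F V]
    (U W : Submodule F V) : ℕ :=
  finrank F ↥(U ⊔ W) - min (finrank F ↥U) (finrank F ↥W)

def rowSpace {F : Type*} [CommRing F] {m n : ℕ} (X : Matrix (Fin m) (Fin n) F) :
    Submodule F (Fin n → F) :=
  LinearMap.range X.vecMulLinear

def colSpace {F : Type*} [CommRing F] {m n : ℕ} (X : Matrix (Fin m) (Fin n) F) :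
    Submodule F (Fin m → F) :=
  LinearMap.range X.mulVecLin

noncomputable def minRankDist {F : Type*} [Field F] {m n : ℕ}
    (C : Set (Matrix (Fin m) (Fin n) F)) : ℕ :=
  sInf {e | ∃ X ∈ C, ∃ Y ∈ C, X ≠ Y ∧ (X - Y).rank = e}

noncomputable def minInjDist {F V : Type*} [Field F] [AddCommGroup V] [Module F V]
    (S : Set (Submodule F V)) : ℕ :=
  sInf {e | ∃ U ∈ S, ∃ W ∈ S, U ≠ W ∧ injDist U W = e}

/-- Maximum cardinality of a nonempty code of `m × n` matrices whose ranks all lie in `I`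
and in which any two distinct codewords are at rank distance at least `d`. -/
noncomputable def maxRankCode (F : Type*) [Field F] [Fintype F] (m n d : ℕ) (I : Set ℕ) : ℕ :=
  sSup {c : ℕ | ∃ C : Set (Matrix (Fin m) (Fin n) F), C.Nonempty ∧
    (∀ X ∈ C, X.rank ∈ I) ∧
    (∀ X ∈ C, ∀ Y ∈ C, X ≠ Y → d ≤ (X - Y).rank) ∧ C.ncard = c}

/-- `A_R(q,m,n,d,r)` : maximum cardinality of a constant-rank code of constant rank `r`
and minimum rank distance at least `d` in `GF(q)^{m × n}`. -/
noncomputable def A_R (F : Type*) [Field F] [Fintype F] (m n d r : ℕ) : ℕ :=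
  maxRankCode F m n d {r}

/-- `A_C(q,n,r,d)` : maximum cardinality of a constant-dimension code of dimension `r`
and minimum injection distance at least `d` in `GF(q)^n`. -/
noncomputable def A_C (F : Type*) [Field F] [Fintype F] (n r d : ℕ) : ℕ :=
  sSup {c : ℕ | ∃ S : Set (Submodule F (Fin n → F)), S.Nonempty ∧
    (∀ U ∈ S, finrank F ↥U = r) ∧
    (∀ U ∈ S, ∀ V ∈ S, U ≠ V → d ≤ injDist U V) ∧ S.ncard = c}

/-- `N_R(q,m,n,r)` : number of `m × n` matrices over `GF(q)` of rank `r`. -/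
noncomputable def N_R (F : Type*) [Field F] [Fintype F] (m n r : ℕ) : ℕ :=
  Nat.card {X : Matrix (Fin m) (Fin n) F // X.rank = r}

/-- `α(m,s) = ∏_{i=0}^{s-1} (q^m - q^i)`. -/
def alphaq (q m s : ℕ) : ℕ := ∏ i ∈ Finset.range s, (q ^ m - q ^ i)

/-- The Gaussian binomial `[n r]_q = α(n,r) / α(r,r)`. -/
def gaussBinom (q n r : ℕ) : ℕ := alphaq q n r / alphaq q r r

/-- `K_q = ∏_{j=1}^∞ (1 - q^{-j})`. -/
noncomputable def Kq (q : ℕ) : ℝ := ∏' j : ℕ, (1 - ((q : ℝ))⁻¹ ^ (j + 1))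

/-- `M(q,m,n,d,r)` : the number of codewords of rank `r` in an `(n, n-d+1, d)` linear MRD
code over `GF(q^m)`. -/
def Mcount (q m n d r : ℕ) : ℤ :=
  (gaussBinom q n r : ℤ) *
    ∑ j ∈ Finset.Icc d r, (-1 : ℤ) ^ (r - j) * (gaussBinom q r j : ℤ) *
      (q : ℤ) ^ ((r - j) * (r - j - 1) / 2) * ((q : ℤ) ^ (m * (j - d + 1)) - 1)


/-- Gaussian binomials by the Pascal recursion. -/
def gb (q : ℕ) : ℕ → ℕ → ℕ
  | _, 0 => 1
  | 0, _ + 1 => 0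
  | n + 1, k + 1 => gb q n k + q ^ (k + 1) * gb q n (k + 1)

theorem gb_zero_right (q n : ℕ) : gb q n 0 = 1 := by cases n <;> simp [gb]

theorem gb_succ (q n k : ℕ) :
    gb q (n + 1) (k + 1) = gb q n k + q ^ (k + 1) * gb q n (k + 1) := by simp [gb]

theorem gb_eq_zero (q : ℕ) : ∀ n k : ℕ, n < k → gb q n k = 0
  | _, 0, h => by omega
  | 0, k + 1, _ => by simp [gb]
  | n + 1, k + 1, h => by
    rw [gb_succ, gb_eq_zero q n k (by omega), gb_eq_zero q n (k + 1) (by omega)]; simp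

theorem gb_self (q : ℕ) : ∀ n : ℕ, gb q n n = 1
  | 0 => by simp [gb]
  | n + 1 => by rw [gb_succ, gb_self q n, gb_eq_zero q n (n + 1) (by omega)]; simp

/-- Integer version of `alphaq`. -/
def alz (q : ℤ) (n k : ℕ) : ℤ := ∏ i ∈ Finset.range k, (q ^ n - q ^ i)

theorem alz_succ (q : ℤ) (n k : ℕ) : alz q n (k + 1) = alz q n k * (q ^ n - q ^ k) := by
  simp [alz, Finset.prod_range_succ]

theorem alz_succ_succ (q : ℤ) (n k : ℕ) :
    alz q (n + 1) (k + 1) = (q ^ (n + 1) - 1) * q ^ k * alz q n k := by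
  unfold alz
  rw [Finset.prod_range_succ']
  have : ∀ i ∈ Finset.range k, (q ^ (n + 1) - q ^ (i + 1)) = q * (q ^ n - q ^ i) := by
    intro i _; ring
  rw [Finset.prod_congr rfl this, Finset.prod_mul_distrib]
  simp; ring

theorem gb_mul_alz (q : ℕ) : ∀ n k : ℕ, (gb q n k : ℤ) * alz q k k = alz q n k
  | n, 0 => by simp [gb_zero_right, alz]
  | 0, k + 1 => by
    simp [gb, alz, Finset.prod_range_succ']
  | n + 1, k + 1 => by
    have h1 := gb_mul_alz q n k
    have h2 := gb_mul_alz q n (k + 1)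
    rw [alz_succ_succ, alz_succ] at h2
    rw [gb_succ, alz_succ_succ, alz_succ_succ]
    push_cast
    linear_combination ((q : ℤ) ^ (k + 1) - 1) * q ^ k * h1 + (q : ℤ) ^ (k + 1) * h2

theorem alphaq_cast {q : ℕ} (hq : 1 ≤ q) (n k : ℕ) : (alphaq q n k : ℤ) = alz q n k := by
  by_cases h : k ≤ n
  · unfold alphaq alz
    rw [Nat.cast_prod]
    refine Finset.prod_congr rfl fun i hi => ?_
    rw [Nat.cast_sub (Nat.pow_le_pow_right hq (by have := Finset.mem_range.1 hi; omega))]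
    push_cast; rfl
  · unfold alphaq alz
    rw [Finset.prod_eq_zero (Finset.mem_range.2 (by omega : n < k)) (by simp),
      Finset.prod_eq_zero (Finset.mem_range.2 (by omega : n < k)) (by simp)]
    simp

theorem alphaq_self_pos {q : ℕ} (hq : 2 ≤ q) (k : ℕ) : 0 < alphaq q k k := by
  refine Finset.prod_pos fun i hi => ?_
  exact Nat.sub_pos_of_lt (Nat.pow_lt_pow_right (by omega) (Finset.mem_range.1 hi))

theorem gb_mul_alphaq {q : ℕ} (hq : 2 ≤ q) (n k : ℕ) :
    gb q n k * alphaq q k k = alphaq q n k := by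
  have := gb_mul_alz q n k
  rw [← alphaq_cast (by omega), ← alphaq_cast (by omega)] at this
  exact_mod_cast this

theorem gaussBinom_eq {q : ℕ} (hq : 2 ≤ q) (n k : ℕ) : gaussBinom q n k = gb q n k := by
  unfold gaussBinom
  rw [← gb_mul_alphaq hq n k, Nat.mul_div_cancel _ (alphaq_self_pos hq k)]

/-- The `q`-factorial up to powers of `q - 1`. -/
def qf (q : ℕ) (n : ℕ) : ℤ := ∏ i ∈ Finset.range n, ((q : ℤ) ^ (i + 1) - 1)

theorem qf_succ (q n : ℕ) : qf q (n + 1) = qf q n * ((q : ℤ) ^ (n + 1) - 1) := by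
  simp [qf, Finset.prod_range_succ]

theorem qf_ne {q : ℕ} (hq : 2 ≤ q) (n : ℕ) : qf q n ≠ 0 := by
  refine Finset.prod_ne_zero_iff.2 fun i _ => ?_
  have : (1 : ℤ) < (q : ℤ) ^ (i + 1) := one_lt_pow₀ (by exact_mod_cast hq) (by omega)
  omega

theorem gb_qf (q : ℕ) : ∀ a b : ℕ, (gb q (a + b) a : ℤ) * qf q a * qf q b = qf q (a + b)
  | 0, b => by simp [gb_zero_right, qf]
  | a + 1, 0 => by simp [gb_self, qf]
  | a + 1, b + 1 => by
    have h1 := gb_qf q a (b + 1)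
    have h2 := gb_qf q (a + 1) b
    rw [show a + 1 + b = a + (b + 1) by ring] at h2
    rw [show a + 1 + (b + 1) = (a + (b + 1)) + 1 by ring, gb_succ, qf_succ q (a + (b + 1)),
      qf_succ q a]
    rw [qf_succ q a] at h2
    rw [qf_succ q b] at h1 ⊢
    push_cast
    linear_combination ((q : ℤ) ^ (a + 1) - 1) * h1 +
      (q : ℤ) ^ (a + 1) * ((q : ℤ) ^ (b + 1) - 1) * h2

theorem gb_symm {q : ℕ} (hq : 2 ≤ q) (a b : ℕ) : gb q (a + b) a = gb q (a + b) b := by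
  have h1 := gb_qf q a b
  have h2 := gb_qf q b a
  rw [add_comm b a] at h2
  have h3 : (gb q (a + b) a : ℤ) = gb q (a + b) b := by
    apply mul_right_cancel₀ (mul_ne_zero (qf_ne hq a) (qf_ne hq b))
    linear_combination h1 - h2
  exact_mod_cast h3

theorem gb_mul_gb {q : ℕ} (hq : 2 ≤ q) (p t e : ℕ) (h : t ≤ e) :
    (gb q (p + t) p : ℤ) * gb q (p + e) (p + t) = gb q (p + e) p * gb q e t := by
  obtain ⟨c, rfl⟩ := Nat.exists_eq_add_of_le h
  have h1 := gb_qf q p t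
  have h2 := gb_qf q (p + t) c
  have h3 := gb_qf q p (t + c)
  have h4 := gb_qf q t c
  rw [← add_assoc] at h3 ⊢
  apply mul_right_cancel₀ (mul_ne_zero (mul_ne_zero (qf_ne hq p) (qf_ne hq t)) (qf_ne hq c))
  linear_combination (gb q (p + t + c) (p + t) : ℤ) * qf q c * h1 + h2 - h3
    - (gb q (p + t + c) p : ℤ) * qf q p * h4

/-- the signed coefficient -/
def sgc (q t : ℕ) : ℤ := (-1) ^ t * (q : ℤ) ^ (t * (t - 1) / 2)

theorem tri_succ (t : ℕ) : (t + 1) * (t + 1 - 1) / 2 = t * (t - 1) / 2 + t := by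
  have := Nat.choose_two_right (t + 1)
  have h2 := Nat.choose_two_right t
  rw [← this, ← h2, Nat.choose_succ_succ' t 1]
  simp; ring

theorem gb_partial (q n T : ℕ) : ∑ t ∈ Finset.range (T + 1), sgc q t * (gb q (n + 1) t : ℤ)
    = (-1) ^ T * (q : ℤ) ^ (T * (T - 1) / 2 + T) * gb q n T := by
  induction T with
  | zero => simp [sgc, gb_zero_right]
  | succ T ih =>
    rw [Finset.sum_range_succ, ih, gb_succ, sgc, tri_succ]
    push_cast
    ring

theorem gb_alt (q N T : ℕ) (h : N ≤ T) :
    ∑ t ∈ Finset.range (T + 1), sgc q t * (gb q N t : ℤ) = if N = 0 then 1 else 0 := by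
  cases N with
  | zero =>
    rw [Finset.sum_range_succ']
    simp [gb, sgc]
  | succ n => rw [gb_partial, gb_eq_zero q n T (by omega)]; simp

theorem gb_inversion {q : ℕ} (hq : 2 ≤ q) (n : ℕ) (B Y : ℕ → ℤ)
    (H : ∀ s ≤ n, ∑ i ∈ Finset.range (n + 1), B i * gb q i s = gb q n s * Y s)
    (p r : ℕ) (hp : p + r = n) :
    B p = gb q n p * ∑ t ∈ Finset.range (r + 1), sgc q t * gb q r t * Y (p + t) := by
  have key : ∑ t ∈ Finset.range (r + 1), sgc q t * gb q (p + t) p *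
      (∑ i ∈ Finset.range (n + 1), B i * gb q i (p + t)) = B p := by
    simp_rw [Finset.mul_sum]
    rw [Finset.sum_comm]
    rw [Finset.sum_eq_single p]
    · rw [Finset.sum_range_succ', Finset.sum_eq_zero]
      · simp [sgc, gb_self]
      · intro t _
        rw [gb_eq_zero q p (p + (t + 1)) (by omega)]; simp
    · intro i hi hip
      by_cases hlt : i < p
      · refine Finset.sum_eq_zero fun t _ => ?_
        rw [gb_eq_zero q i (p + t) (by omega)]; simp
      · obtain ⟨e, rfl⟩ := Nat.exists_eq_add_of_le (not_lt.1 hlt)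
        have he : e ≤ r := by have := Finset.mem_range.1 hi; omega
        have := gb_alt q e r he
        rw [if_neg (by omega)] at this
        calc _ = ∑ t ∈ Finset.range (r + 1), B (p + e) * gb q (p + e) p *
              (sgc q t * gb q e t) := by
              refine Finset.sum_congr rfl fun t _ => ?_
              by_cases hte : t ≤ e
              · linear_combination B (p + e) * sgc q t * gb_mul_gb hq p t e hte
              · rw [gb_eq_zero q e t (by omega), gb_eq_zero q (p + e) (p + t) (by omega)]; simp
          _ = 0 := by rw [← Finset.mul_sum, this, mul_zero]
    · intro h; exact absurd (Finset.mem_range.2 (by omega)) h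
  rw [← key, Finset.mul_sum]
  refine Finset.sum_congr rfl fun t ht => ?_
  have ht' := Finset.mem_range.1 ht
  rw [H _ (by omega)]
  subst hp
  linear_combination sgc q t * Y (p + t) * gb_mul_gb hq p t r (by omega)

theorem Mcount_eq {q m n d r : ℕ} (hq : 2 ≤ q) (hd2 : 2 ≤ d) (hdr : d ≤ r) (hrn : r ≤ n) :
    Mcount q m n d r = gb q n (n - r) * ∑ t ∈ Finset.range (r + 1),
      sgc q t * gb q r t * ((q : ℤ) ^ m) ^ (n - d + 1 - (n - r + t)) := by
  have h0 := gb_alt q r r le_rfl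
  rw [if_neg (by omega)] at h0
  have h1 : ∑ t ∈ Finset.range (r + 1),
      sgc q t * gb q r t * ((q : ℤ) ^ m) ^ (n - d + 1 - (n - r + t)) =
      ∑ t ∈ Finset.range (r + 1),
      sgc q t * gb q r t * (((q : ℤ) ^ m) ^ (n - d + 1 - (n - r + t)) - 1) := by
    simp_rw [mul_sub, mul_one]
    rw [Finset.sum_sub_distrib, h0, sub_zero]
  rw [h1]
  unfold Mcount
  have h2 : gb q n (n - r) = gb q n r := by
    have := gb_symm hq (n - r) r
    rwa [show n - r + r = n by omega] at this
  rw [gaussBinom_eq hq, h2, ← Finset.sum_range_reflect]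
  congr 1
  rw [← Finset.sum_subset (s₁ := Finset.Icc d r) (s₂ := Finset.range (r + 1))]
  · refine Finset.sum_congr rfl fun j hj => ?_
    have hj' := Finset.mem_Icc.1 hj
    have h3 : gb q r (r + 1 - 1 - j) = gb q r j := by
      have := gb_symm hq (r - j) j
      rwa [show r - j + j = r by omega] at this
    rw [h3, gaussBinom_eq hq, ← pow_mul, sgc]
    rw [show r + 1 - 1 - j = r - j by omega, show n - d + 1 - (n - r + (r - j)) = j - d + 1 by omega]
    ring
  · intro j hj
    have hj' := Finset.mem_Icc.1 hj
    exact Finset.mem_range.2 (by omega)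
  · intro j hj hj2
    have hj' := Finset.mem_range.1 hj
    have : j < d := by
      by_contra h; exact hj2 (Finset.mem_Icc.2 ⟨by omega, by omega⟩)
    rw [show n - d + 1 - (n - r + (r + 1 - 1 - j)) = 0 by omega]; simp

/-- alternating sums with increasing terms -/
theorem alt_bound (T : ℕ → ℤ) (d r : ℕ) (hnn : ∀ j, d ≤ j → j ≤ r → 0 ≤ T j)
    (hmono : ∀ j, d ≤ j → j + 1 ≤ r → T j ≤ T (j + 1)) (e : ℕ) (he : d + e ≤ r) :
    0 ≤ ∑ j ∈ Finset.Icc d (d + e), (-1) ^ (d + e - j) * T j ∧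
    ∑ j ∈ Finset.Icc d (d + e), (-1) ^ (d + e - j) * T j ≤ T (d + e) := by
  induction e with
  | zero => simpa using hnn d le_rfl he
  | succ e ih =>
    have ih := ih (by omega)
    have hm := hmono (d + e) (by omega) (by omega)
    have : ∑ j ∈ Finset.Icc d (d + (e + 1)), (-1) ^ (d + (e + 1) - j) * T j =
        T (d + (e + 1)) - ∑ j ∈ Finset.Icc d (d + e), (-1) ^ (d + e - j) * T j := by
      rw [← add_assoc, Finset.sum_Icc_succ_top (by omega), sub_eq_neg_add,
        ← Finset.sum_neg_distrib]
      congr 1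
      · refine Finset.sum_congr rfl fun j hj => ?_
        have hj' := Finset.mem_Icc.1 hj
        rw [show d + e + 1 - j = d + e - j + 1 by omega]
        ring
      · simp
    rw [this]
    rw [← add_assoc]
    constructor <;> linarith [ih.1, ih.2]

theorem gb_ratio {q : ℕ} (hq : 2 ≤ q) (j b : ℕ) :
    (gb q (j + 1 + b) (j + 1) : ℤ) * ((q : ℤ) ^ (j + 1) - 1) =
      gb q (j + 1 + b) j * ((q : ℤ) ^ (b + 1) - 1) := by
  have h1 := gb_qf q (j + 1) b
  have h2 := gb_qf q j (b + 1)
  rw [qf_succ] at h1 h2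
  rw [show j + (b + 1) = j + 1 + b by ring] at h2
  apply mul_right_cancel₀ (mul_ne_zero (qf_ne hq j) (qf_ne hq b))
  linear_combination h1 - h2

theorem sum_lower {q m d r : ℕ} (hq : 2 ≤ q) (hd2 : 2 ≤ d) (hdr : d ≤ r) (hrm : r ≤ m) :
    (q : ℤ) ^ (m * (r - d)) < ∑ j ∈ Finset.Icc d r, (-1 : ℤ) ^ (r - j) * (gb q r j : ℤ) *
      (q : ℤ) ^ ((r - j) * (r - j - 1) / 2) * ((q : ℤ) ^ (m * (j - d + 1)) - 1) := by
  have hqz : (2 : ℤ) ≤ q := by exact_mod_cast hq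
  obtain ⟨Q, hQ⟩ : ∃ Q : ℤ, Q = (q : ℤ) ^ m := ⟨_, rfl⟩
  have hQle : ∀ i ≤ m, (q : ℤ) ^ i ≤ Q := fun i hi => by
    rw [hQ]; exact pow_le_pow_right₀ (by linarith) hi
  have hQ4 : 4 ≤ Q := by
    have := hQle 2 (by omega)
    nlinarith
  have hQpos : ∀ a : ℕ, 1 ≤ Q ^ a := fun a => one_le_pow₀ (by linarith)
  let T : ℕ → ℤ := fun j => (gb q r j : ℤ) *
      (q : ℤ) ^ ((r - j) * (r - j - 1) / 2) * (Q ^ (j - d + 1) - 1)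
  have hT : ∀ j, T j = (gb q r j : ℤ) *
      (q : ℤ) ^ ((r - j) * (r - j - 1) / 2) * (Q ^ (j - d + 1) - 1) := fun j => rfl
  have hnn : ∀ j, d ≤ j → j ≤ r → 0 ≤ T j := fun j _ _ => by
    rw [hT]
    have := hQpos (j - d + 1)
    exact mul_nonneg (by positivity) (by linarith)
  have hmono : ∀ j, d ≤ j → j + 1 ≤ r → T j ≤ T (j + 1) := by
    intro j hdj hjr
    obtain ⟨b, hb⟩ := Nat.exists_eq_add_of_le hjr
    have hrat := gb_ratio hq j b
    rw [← hb] at hrat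
    rw [hT, hT]
    rw [show r - (j + 1) = b by omega, show r - j = b + 1 by omega, tri_succ,
      show j + 1 - d + 1 = (j - d + 1) + 1 by omega]
    set a := j - d + 1
    have hqb : (1 : ℤ) ≤ (q : ℤ) ^ b := one_le_pow₀ (by linarith)
    have hqb1 : (q : ℤ) ^ b ≤ (q : ℤ) ^ (b + 1) - 1 := by rw [pow_succ]; nlinarith
    have hj1 := hQle (j + 1) (by omega)
    have hj2 : (1 : ℤ) ≤ (q : ℤ) ^ (j + 1) := one_le_pow₀ (by linarith)
    have hQa := hQpos a
    have h1 : ((q : ℤ) ^ (j + 1) - 1) * (Q ^ a - 1) ≤ Q ^ (a + 1) - 1 := by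
      rw [pow_succ Q a]
      nlinarith [mul_nonneg (sub_nonneg.2 hj1) (sub_nonneg.2 hQa)]
    have h2 : (q : ℤ) ^ b * (((q : ℤ) ^ (j + 1) - 1) * (Q ^ a - 1)) ≤
        ((q : ℤ) ^ (b + 1) - 1) * (Q ^ (a + 1) - 1) :=
      mul_le_mul hqb1 h1 (mul_nonneg (by linarith) (by linarith)) (by linarith)
    have hpos : (0 : ℤ) < (q : ℤ) ^ (b + 1) - 1 := by linarith
    refine le_of_mul_le_mul_left ?_ hpos
    have h3 := mul_le_mul_of_nonneg_left h2
      (show (0 : ℤ) ≤ (gb q r (j + 1) : ℤ) * (q : ℤ) ^ (b * (b - 1) / 2) by positivity)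
    rw [pow_add]
    calc _ = (gb q r (j + 1) : ℤ) * (q : ℤ) ^ (b * (b - 1) / 2) *
          ((q : ℤ) ^ b * (((q : ℤ) ^ (j + 1) - 1) * (Q ^ a - 1))) := by
            linear_combination -(q : ℤ) ^ (b * (b - 1) / 2) * (q : ℤ) ^ b * (Q ^ a - 1) * hrat
      _ ≤ _ := h3
      _ = _ := by ring
  have hsum : ∑ j ∈ Finset.Icc d r, (-1 : ℤ) ^ (r - j) * (gb q r j : ℤ) *
      (q : ℤ) ^ ((r - j) * (r - j - 1) / 2) * ((q : ℤ) ^ (m * (j - d + 1)) - 1)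
      = ∑ j ∈ Finset.Icc d r, (-1 : ℤ) ^ (r - j) * T j := by
    refine Finset.sum_congr rfl fun j _ => ?_
    rw [hT, pow_mul, ← hQ]; ring
  rw [hsum, pow_mul, ← hQ]
  have hTr : T r = Q ^ (r - d + 1) - 1 := by rw [hT, gb_self]; simp
  rcases Nat.eq_or_lt_of_le hdr with h | h
  · subst h
    simp only [Finset.Icc_self, Finset.sum_singleton, hTr]
    simp; linarith
  · obtain ⟨e, rfl⟩ := Nat.exists_eq_add_of_lt h
    have hb := (alt_bound T d _ hnn hmono e (by omega)).2
    have hT1 : T (d + e) ≤ (Q - 1) * (Q ^ (e + 1) - 1) := by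
      have hrat := gb_ratio hq (d + e) 0
      simp only [add_zero, gb_self, zero_add, pow_one] at hrat
      rw [hT, show d + e - d + 1 = e + 1 by omega]
      refine mul_le_mul_of_nonneg_right ?_ (by linarith [hQpos (e + 1)])
      rw [show d + e + 1 - (d + e) = 1 by omega]
      simp only [Nat.sub_self, mul_zero, Nat.zero_div, pow_zero, mul_one]
      have h1 := hQle (d + e + 1) (by omega)
      have h2 : (0 : ℤ) ≤ gb q (d + e + 1) (d + e) := by positivity
      push_cast at hrat
      nlinarith
    have hS : ∑ j ∈ Finset.Icc d (d + e + 1), (-1) ^ (d + e + 1 - j) * T j =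
        T (d + e + 1) - ∑ j ∈ Finset.Icc d (d + e), (-1) ^ (d + e - j) * T j := by
      rw [Finset.sum_Icc_succ_top (by omega), sub_eq_neg_add,
        ← Finset.sum_neg_distrib]
      congr 1
      · refine Finset.sum_congr rfl fun j hj => ?_
        have hj' := Finset.mem_Icc.1 hj
        rw [show d + e + 1 - j = d + e - j + 1 by omega]
        ring
      · simp
    rw [hS, hTr, show d + e + 1 - d + 1 = e + 1 + 1 by omega, show d + e + 1 - d = e + 1 by omega,
      pow_succ Q (e + 1)]
    nlinarith

theorem gb_pos {q : ℕ} (hq : 2 ≤ q) {n k : ℕ} (h : k ≤ n) : 0 < gb q n k := by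
  obtain ⟨b, rfl⟩ := Nat.exists_eq_add_of_le h
  have := gb_qf q k b
  rcases Nat.eq_zero_or_pos (gb q (k + b) k) with h0 | h0
  · rw [h0] at this
    exact absurd this.symm (by simpa using qf_ne hq (k + b))
  · exact h0

theorem part_two {q m n d r : ℕ} (hq : 2 ≤ q)
    (hd2 : 2 ≤ d) (hdr : d ≤ r) (hrn : r ≤ n) (hnm : n ≤ m) :
      (gaussBinom q n r : ℤ) * (q : ℤ) ^ (m * (r - d)) < Mcount q m n d r := by
  unfold Mcount
  simp_rw [gaussBinom_eq hq]
  refine mul_lt_mul_of_pos_left (sum_lower hq hd2 hdr (by omega)) ?_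
  exact_mod_cast gb_pos hq hrn

section code
variable {F K : Type*} [Field F] [Fintype F] [Field K] [Fintype K] [Algebra F K]

/-- linearized polynomial with coefficients `c`, as an `F`-linear map -/
noncomputable def linPoly (F : Type*) {K : Type*} [Field F] [Fintype F] [Field K] [Algebra F K]
    {k : ℕ} (c : Fin k → K) : K →ₗ[F] K :=
  ∑ i : Fin k, c i • ((FiniteField.frobeniusAlgHom F K) ^ (i : ℕ)).toLinearMap

theorem linPoly_apply {F K : Type*} [Field F] [Fintype F] [Field K] [Algebra F K] {k : ℕ} (c : Fin k → K) (x : K) :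
    linPoly F c x = ∑ i : Fin k, c i * x ^ (Fintype.card F ^ (i : ℕ)) := by
  simp only [linPoly, LinearMap.sum_apply, LinearMap.smul_apply, AlgHom.toLinearMap_apply,
    AlgHom.coe_pow, FiniteField.coe_frobeniusAlgHom, pow_iterate, smul_eq_mul]

/-- a linearized polynomial of `q`-degree `< k` vanishing on `k` independent elements is zero -/
theorem linPoly_zero_of {k : ℕ} (c : Fin k → K) (w : Fin k → K) (hw : LinearIndependent F w)
    (h : ∀ i, linPoly F c (w i) = 0) : c = 0 := by
  classical
  rcases Nat.eq_zero_or_pos k with hk | hk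
  · subst hk; exact Subsingleton.elim _ _
  set q := Fintype.card F with hq
  have hq1 : 1 < q := Fintype.one_lt_card
  let P : Polynomial K := ∑ i : Fin k, Polynomial.C (c i) * Polynomial.X ^ (q ^ (i : ℕ))
  have hPe : ∀ x, P.eval x = linPoly F c x := by
    intro x; simp [P, Polynomial.eval_finsetSum, linPoly_apply, hq]
  have hdeg : P.natDegree < q ^ k := by
    refine lt_of_le_of_lt (b := q ^ (k - 1)) ?_ (Nat.pow_lt_pow_right hq1 (by omega))
    refine Polynomial.natDegree_sum_le_of_forall_le _ _ fun i _ => ?_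
    refine (Polynomial.natDegree_C_mul_X_pow_le _ _).trans ?_
    exact Nat.pow_le_pow_right (by omega) (by omega)
  have hP : P = 0 := by
    refine Polynomial.eq_zero_of_natDegree_lt_card_of_eval_eq_zero P
      (f := fun a : Fin k → F => Fintype.linearCombination F w a) ?_ ?_ ?_
    · exact hw.fintypeLinearCombination_injective
    · intro a
      rw [hPe, Fintype.linearCombination_apply, map_sum]
      simp [h]
    · simpa [hq] using hdeg
  funext i
  have := congrArg (fun p => Polynomial.coeff p (q ^ (i : ℕ))) hP
  simp only [P, Polynomial.finsetSum_coeff, Polynomial.coeff_C_mul, Polynomial.coeff_X_pow,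
    Polynomial.coeff_zero] at this
  rw [Finset.sum_eq_single i] at this
  · simpa using this
  · intro j _ hj
    rw [if_neg]; simp
    intro he
    exact hj (Fin.ext (Nat.pow_right_injective hq1 he).symm)
  · simp

/-- the evaluation map, `K`-linear in the coefficients -/
noncomputable def evalMap (F : Type*) {K : Type*} [Field F] [Fintype F] [Field K] [Algebra F K]
    (k : ℕ) {s : ℕ} (w : Fin s → K) : (Fin k → K) →ₗ[K] (Fin s → K) where
  toFun c i := linPoly F c (w i)
  map_add' c c' := by
    funext i; simp [linPoly_apply, add_mul, Finset.sum_add_distrib]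
  map_smul' a c := by
    funext i; simp [linPoly_apply, Finset.mul_sum, mul_assoc]

theorem exists_extend {V : Type*} [AddCommGroup V] [Module F V] [FiniteDimensional F V] {s : ℕ}
    (w : Fin s → V) (hw : LinearIndependent F w) (t : ℕ) (h : s + t ≤ finrank F V) :
    ∃ w' : Fin (s + t) → V, LinearIndependent F w' ∧ ∀ i : Fin s, w' (Fin.castAdd t i) = w i := by
  induction t with
  | zero => exact ⟨w, hw, fun i => rfl⟩
  | succ t ih =>
    obtain ⟨w', hw', he⟩ := ih (by omega)
    obtain ⟨x, hx⟩ := exists_linearIndependent_snoc_of_lt_finrank hw' (by omega)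
    refine ⟨Fin.snoc w' x, hx, fun i => ?_⟩
    rw [← he i]
    exact Fin.snoc_castSucc (α := fun _ => V) x w' (Fin.castAdd t i)

theorem finrank_ker_evalMap {k s : ℕ} (hk : k ≤ finrank F K) (w : Fin s → K)
    (hw : LinearIndependent F w) : finrank K (LinearMap.ker (evalMap F k w)) = k - s := by
  rcases le_total k s with h | h
  · rw [Nat.sub_eq_zero_of_le h]
    have : LinearMap.ker (evalMap F k w) = ⊥ := by
      rw [LinearMap.ker_eq_bot']
      intro c hc
      refine linPoly_zero_of (F := F) c (w ∘ Fin.castLE h)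
        (hw.comp _ (Fin.castLE_injective h)) fun i => ?_
      exact congrFun hc (Fin.castLE h i)
    rw [this]; simp
  · obtain ⟨t, rfl⟩ := Nat.exists_eq_add_of_le h
    obtain ⟨w', hw', he⟩ := exists_extend w hw t hk
    have hinj : Function.Injective (evalMap F (s + t) w') := by
      rw [← LinearMap.ker_eq_bot, LinearMap.ker_eq_bot']
      intro c hc
      exact linPoly_zero_of (F := F) c w' hw' fun i => congrFun hc i
    have hsurj := LinearMap.surjective_of_injective hinj
    have hs : Function.Surjective (evalMap F (s + t) w) := by
      intro y
      obtain ⟨c, hc⟩ := hsurj (Fin.append y 0)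
      refine ⟨c, funext fun i => ?_⟩
      have := congrFun hc (Fin.castAdd t i)
      rw [Fin.append_left] at this
      rw [← this]
      change linPoly F c (w i) = linPoly F c _
      rw [he]
    have := LinearMap.finrank_range_add_finrank_ker (evalMap F (s + t) w)
    rw [LinearMap.range_eq_top.2 hs] at this
    simp at this
    omega

theorem card_indep {V : Type*} [AddCommGroup V] [Module F V] [Finite V] (s : ℕ) :
    Nat.card {u : Fin s → V // LinearIndependent F u} = alphaq (Fintype.card F) (finrank F V) s := by
  have := Fintype.ofFinite V
  by_cases h : s ≤ finrank F V
  · rw [card_linearIndependent h, alphaq, Finset.prod_range]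
  · have h1 : IsEmpty {u : Fin s → V // LinearIndependent F u} := by
      refine ⟨fun u => h ?_⟩
      simpa using u.2.fintype_card_le_finrank
    rw [Nat.card_of_isEmpty, alphaq,
      Finset.prod_eq_zero (Finset.mem_range.2 (not_le.1 h)) (by simp)]

/-- restriction of the linearized polynomial to the span of a family -/
noncomputable def codeMap {n k : ℕ} (w : Fin n → K) (c : Fin k → K) : (Fin n → F) →ₗ[F] K :=
  linPoly F c ∘ₗ Fintype.linearCombination F w

theorem double_count {n k s : ℕ} (hk : k ≤ finrank F K) (w : Fin n → K)
    (hw : LinearIndependent F w) :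
    ∑ c : Fin k → K, alphaq (Fintype.card F)
      (finrank F (LinearMap.ker (codeMap (F := F) w c))) s =
    alphaq (Fintype.card F) n s * (Fintype.card K) ^ (k - s) := by
  classical
  let U := {u : Fin s → (Fin n → F) // LinearIndependent F u}
  have h1 : ∀ c : Fin k → K, alphaq (Fintype.card F)
      (finrank F (LinearMap.ker (codeMap (F := F) w c))) s =
      Nat.card {u : U // ∀ i, codeMap (F := F) w c (u.1 i) = 0} := by
    intro c
    rw [← card_indep]
    refine Nat.card_congr ⟨fun u => ⟨⟨fun i => (u.1 i : Fin n → F), ?_⟩, fun i => ?_⟩,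
      fun u => ⟨fun i => ⟨u.1.1 i, u.2 i⟩, ?_⟩, fun u => rfl, fun u => rfl⟩
    · exact u.2.map' (Submodule.subtype _) (Submodule.ker_subtype _)
    · exact (u.1 i).2
    · exact LinearIndependent.of_comp (Submodule.subtype _) u.1.2
  have h2 : ∀ u : U, Nat.card {c : Fin k → K // ∀ i, codeMap (F := F) w c (u.1 i) = 0} =
      Fintype.card K ^ (k - s) := by
    intro u
    have hli : LinearIndependent F (fun i => Fintype.linearCombination F w (u.1 i)) :=
      u.2.map' _ (LinearMap.ker_eq_bot.2 hw.fintypeLinearCombination_injective)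
    rw [← finrank_ker_evalMap hk _ hli, ← Nat.card_eq_fintype_card (α := K),
      ← Module.natCard_eq_pow_finrank]
    refine Nat.card_congr (Equiv.subtypeEquivRight fun c => ?_)
    rw [LinearMap.mem_ker, funext_iff]
    rfl
  have h3 : Nat.card (Σ c : Fin k → K, {u : U // ∀ i, codeMap (F := F) w c (u.1 i) = 0}) =
      Nat.card (Σ u : U, {c : Fin k → K // ∀ i, codeMap (F := F) w c (u.1 i) = 0}) :=
    Nat.card_congr ⟨fun x => ⟨x.2.1, x.1, x.2.2⟩, fun x => ⟨x.2.1, x.1, x.2.2⟩,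
      fun _ => rfl, fun _ => rfl⟩
  rw [Nat.card_sigma, Nat.card_sigma] at h3
  simp_rw [h1, h3, h2]
  rw [Finset.sum_const, Finset.card_univ, ← Nat.card_eq_fintype_card (α := U), card_indep]
  simp

theorem count_kernel {n k : ℕ} (hk : k ≤ finrank F K) (w : Fin n → K)
    (hw : LinearIndependent F w) (p r : ℕ) (hp : p + r = n) :
    (Nat.card {c : Fin k → K // finrank F (LinearMap.ker (codeMap (F := F) w c)) = p} : ℤ) =
    gb (Fintype.card F) n p * ∑ t ∈ Finset.range (r + 1), sgc (Fintype.card F) t *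
      gb (Fintype.card F) r t * (Fintype.card K : ℤ) ^ (k - (p + t)) := by
  classical
  have hq : 2 ≤ Fintype.card F := Fintype.one_lt_card
  let D : (Fin k → K) → ℕ := fun c => finrank F (LinearMap.ker (codeMap (F := F) w c))
  refine gb_inversion hq n (fun i => (Nat.card {c : Fin k → K // D c = i} : ℤ))
    (fun s => (Fintype.card K : ℤ) ^ (k - s)) ?_ p r hp
  intro s _
  have h := double_count (s := s) hk w hw
  have hD : ∀ c, D c < n + 1 := fun c => by
    have := Submodule.finrank_le (LinearMap.ker (codeMap (F := F) w c))
    simp at this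
    exact Nat.lt_succ_of_le this
  rw [← gb_mul_alphaq hq n s,
    Finset.sum_congr rfl (fun c _ => (gb_mul_alphaq hq (D c) s).symm), ← Finset.sum_mul] at h
  have h' : ∑ c : Fin k → K, gb (Fintype.card F) (D c) s =
      gb (Fintype.card F) n s * Fintype.card K ^ (k - s) := by
    apply Nat.eq_of_mul_eq_mul_right (alphaq_self_pos hq s)
    rw [h]; ring
  have h'' : ∑ c : Fin k → K, gb (Fintype.card F) (D c) s = ∑ i ∈ Finset.range (n + 1),
      Nat.card {c : Fin k → K // D c = i} * gb (Fintype.card F) i s := by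
    rw [← Finset.sum_fiberwise_of_maps_to (g := D) (t := Finset.range (n + 1))
      (fun c _ => Finset.mem_range.2 (hD c))]
    refine Finset.sum_congr rfl fun i _ => ?_
    rw [Finset.sum_congr rfl (g := fun _ => gb (Fintype.card F) i s)
      (fun c hc => by rw [(Finset.mem_filter.1 hc).2])]
    rw [Finset.sum_const, smul_eq_mul, Nat.card_eq_fintype_card, Fintype.card_subtype]
  rw [h''] at h'
  exact_mod_cast h'

theorem codeMap_sub {n k : ℕ} (w : Fin n → K) (c c' : Fin k → K) :
    codeMap (F := F) w (c - c') = codeMap w c - codeMap w c' := by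
  ext v; simp [codeMap, linPoly_apply, sub_mul, Finset.sum_sub_distrib]

theorem ker_lt {n k : ℕ} (w : Fin n → K) (hw : LinearIndependent F w) (c : Fin k → K)
    (hc : c ≠ 0) : finrank F (LinearMap.ker (codeMap (F := F) w c)) < k := by
  by_contra! h
  have hb := (Module.finBasis F (LinearMap.ker (codeMap (F := F) w c))).linearIndependent
  have h1 := (hb.map' (Submodule.subtype _) (Submodule.ker_subtype _)).map'
    (Fintype.linearCombination F w) (LinearMap.ker_eq_bot.2 hw.fintypeLinearCombination_injective)
  refine hc (linPoly_zero_of (F := F) c _ (h1.comp _ (Fin.castLE_injective h)) fun i => ?_)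
  exact (Module.finBasis F (LinearMap.ker (codeMap (F := F) w c)) (Fin.castLE h i)).2

theorem rank_code {m n k : ℕ} (b : Basis (Fin m) F K) (w : Fin n → K) (c : Fin k → K) :
    (LinearMap.toMatrix (Pi.basisFun F (Fin n)) b (codeMap w c)).rank +
      finrank F (LinearMap.ker (codeMap (F := F) w c)) = n := by
  rw [Matrix.rank_eq_finrank_range_toLin _ b (Pi.basisFun F (Fin n)), Matrix.toLin_toMatrix]
  simpa using LinearMap.finrank_range_add_finrank_ker (codeMap (F := F) w c)

end code

theorem exists_ext (F : Type*) [Field F] [Fintype F] (m : ℕ) (hm : m ≠ 0) :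
    ∃ (K : Type) (_ : Field K) (_ : Fintype K) (_ : Algebra F K), finrank F K = m := by
  obtain ⟨p, hp⟩ := CharP.exists F
  have := Fact.mk (CharP.char_is_prime F p)
  have : NeZero m := ⟨hm⟩
  exact ⟨FiniteField.Extension F p m, inferInstance, Fintype.ofFinite _, inferInstance,
    FiniteField.finrank_extension F p m⟩

theorem stmt16 {q m n d r : ℕ} (F : Type*) [Field F] [Fintype F] (hF : Fintype.card F = q)
    (hd2 : 2 ≤ d) (hdr : d ≤ r) (hrn : r ≤ n) (hnm : n ≤ m) :
    Mcount q m n d r ≤ (A_R F m n d r : ℤ) ∧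
      (gaussBinom q n r : ℤ) * (q : ℤ) ^ (m * (r - d)) < Mcount q m n d r := by
  have hq : 2 ≤ q := hF ▸ Fintype.one_lt_card
  have h2 := part_two hq hd2 hdr hrn hnm
  refine ⟨?_, h2⟩
  obtain ⟨K, _, _, _, hK⟩ := exists_ext F m (by omega)
  have : FiniteDimensional F K := Module.finite_of_finrank_pos (by omega)
  let b : Basis (Fin m) F K := Module.finBasisOfFinrankEq F K hK
  let w : Fin n → K := b ∘ Fin.castLE hnm
  have hw : LinearIndependent F w := b.linearIndependent.comp _ (Fin.castLE_injective hnm)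
  have hcK : (Fintype.card K : ℤ) = (q : ℤ) ^ m := by
    rw [Module.card_eq_pow_finrank (K := F) (V := K), hK, hF]; push_cast; rfl
  have hcount := count_kernel (k := n - d + 1) (F := F) (by omega) w hw (n - r) r (by omega)
  rw [hF, hcK, ← Mcount_eq hq hd2 hdr hrn] at hcount
  let X : (Fin (n - d + 1) → K) → Matrix (Fin m) (Fin n) F :=
    fun c => LinearMap.toMatrix (Pi.basisFun F (Fin n)) b (codeMap w c)
  have hXsub : ∀ c c', X c - X c' = X (c - c') := fun c c' => by
    simp only [X, codeMap_sub, map_sub]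
  have hXd : ∀ c, c ≠ 0 → d ≤ (X c).rank := fun c hc => by
    have h3 := ker_lt (F := F) w hw c hc
    have h4 := rank_code (F := F) b w c
    change d ≤ (LinearMap.toMatrix (Pi.basisFun F (Fin n)) b (codeMap w c)).rank
    omega
  have hXinj : Function.Injective X := by
    intro c c' h
    by_contra hne
    have h3 := hXd (c - c') (sub_ne_zero.2 hne)
    rw [← hXsub, h, sub_self, Matrix.rank_zero] at h3
    omega
  let S : Set (Fin (n - d + 1) → K) :=
    {c | finrank F (LinearMap.ker (codeMap (F := F) w c)) = n - r}
  have hS : ((Set.image X S).ncard : ℤ) = Mcount q m n d r := by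
    rw [Set.ncard_image_of_injective _ hXinj, ← hcount]
    rfl
  rw [← hS]
  norm_cast
  refine le_csSup ⟨Nat.card (Matrix (Fin m) (Fin n) F), ?_⟩ ⟨Set.image X S, ?_, ?_, ?_, rfl⟩
  · rintro _ ⟨C, _, _, _, rfl⟩
    exact Set.ncard_le_card C
  · rw [← Set.ncard_pos]
    have : (0 : ℤ) < ((Set.image X S).ncard : ℤ) := by
      rw [hS]
      exact lt_of_le_of_lt (by positivity) h2
    exact_mod_cast this
  · rintro _ ⟨c, hc, rfl⟩
    have h4 := rank_code (F := F) b w c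
    have h5 : finrank F (LinearMap.ker (codeMap (F := F) w c)) = n - r := hc
    change (LinearMap.toMatrix (Pi.basisFun F (Fin n)) b (codeMap w c)).rank = r
    omega
  · rintro _ ⟨c, _, rfl⟩ _ ⟨c', _, rfl⟩ hne
    rw [hXsub]
    exact hXd _ (sub_ne_zero.2 fun h => hne (by rw [h]))
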